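/- arXiv:2107.13094 — 3 statements merged into one kernel-verified Lean document; each statement's English description precedes it below -/
import Mathlib

section
/- Let p ≥ 1 and let ℓ_1, …, ℓ_p be the Lagrange basis polynomials for the p Chebyshev nodes of the first kind x_j = cos((2j−1)π/(2p)) on [−1,1]. Then for every x ∈ [−1,1], ∑_{k=1}^p ℓ_k(x)² ≤ ∑_{k=1}^p ℓ_k(1)² = 2 − 1/p. -/
noncomputable section

/-- The `j`-th Chebyshev node of the first kind on `[-1,1]`, for `p` nodes
(0-indexed: `x_j = cos((2j+1)π/(2p))`). -/
def chebNode (p : ℕ) (j : Fin p) : ℝ :=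
  Real.cos ((2 * (j : ℝ) + 1) * Real.pi / (2 * p))

/-- The Lagrange basis polynomial for the `p` Chebyshev nodes of the first kind,
evaluated at `x`. -/
def chebLagrange (p : ℕ) (k : Fin p) (x : ℝ) : ℝ :=
  (Lagrange.basis Finset.univ (chebNode p) k).eval x

open Polynomial Polynomial.Chebyshev in
/-- The Chebyshev nodes are pairwise distinct. -/
theorem chebNode_injective (p : ℕ) : Function.Injective (chebNode p) := by
  intro i j h
  have hinj := (Finset.range p).nodup_map_iff_injOn.mp (roots_T_real_nodup p)
  exact Fin.ext (hinj (by simp) (by simp) h)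

open Polynomial Polynomial.Chebyshev in
/-- The values of `T_n` at the `p` Chebyshev nodes sum to `0` for `0 < n < 2p`. -/
theorem sum_eval_T_chebNode_eq_zero (p : ℕ) (n : ℤ) (hn : ¬ (2 * p : ℤ) ∣ n) :
    ∑ k : Fin p, (T ℝ n).eval (chebNode p k) = 0 := by
  rcases eq_or_ne p 0 with rfl | hp
  · simp
  have h := sumZeroes_T_of_not_dvd hn
  have hp' : (p : ℝ) ≠ 0 := by exact_mod_cast hp
  rw [sumZeroes, mul_eq_zero_iff_left (div_ne_zero Real.pi_ne_zero hp'),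
    ← Fin.sum_univ_eq_sum_range
      (fun i : ℕ => (T ℝ n).eval (Real.cos ((2 * (i : ℝ) + 1) / (2 * p) * Real.pi)))] at h
  rw [← h]
  refine Finset.sum_congr rfl fun k _ => ?_
  rw [chebNode, div_mul_eq_mul_div]

/-- The normalising weights `1/p, 2/p, …, 2/p` of the discrete Chebyshev transform. -/
def chebWeight (p : ℕ) (m : Fin p) : ℝ :=
  if (m : ℕ) = 0 then 1 / p else 2 / p

open Polynomial Polynomial.Chebyshev in
/-- Discrete orthogonality of the Chebyshev polynomials at the Chebyshev nodes. -/
theorem chebWeight_mul_sum_eval_T (p : ℕ) (m n : Fin p) :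
    chebWeight p m * ∑ k : Fin p,
      (T ℝ (m : ℕ)).eval (chebNode p k) * (T ℝ (n : ℕ)).eval (chebNode p k) =
      if m = n then 1 else 0 := by
  have hp : (p : ℝ) ≠ 0 := by exact_mod_cast (Fin.pos m).ne'
  have hm := m.isLt
  have hn := n.isLt
  have key : 2 * ∑ k : Fin p,
      (T ℝ (m : ℕ)).eval (chebNode p k) * (T ℝ (n : ℕ)).eval (chebNode p k) =
      ∑ k : Fin p, (T ℝ ((m : ℕ) + (n : ℕ) : ℤ)).eval (chebNode p k) +
      ∑ k : Fin p, (T ℝ ((m : ℕ) - (n : ℕ) : ℤ)).eval (chebNode p k) := by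
    rw [← Finset.sum_add_distrib, Finset.mul_sum]
    refine Finset.sum_congr rfl fun k _ => ?_
    rw [← eval_add, ← T_mul_T]
    simp [mul_assoc]
  have not_dvd (a : ℤ) (h0 : a ≠ 0) (h1 : |a| < 2 * p) : ¬ (2 * p : ℤ) ∣ a := fun h =>
    h0 (Int.eq_zero_of_abs_lt_dvd h h1)
  by_cases hmn : m = n
  · subst hmn
    by_cases h0 : (m : ℕ) = 0
    · simp [chebWeight, h0, hp]
    · rw [sum_eval_T_chebNode_eq_zero p _
        (not_dvd _ (by omega) (by rw [abs_lt]; omega))] at key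
      simp only [sub_self, T_zero, eval_one, Finset.sum_const, Finset.card_univ, Fintype.card_fin,
        nsmul_eq_mul, mul_one, zero_add] at key
      simp only [chebWeight, h0, if_false, if_true]
      rw [div_mul_eq_mul_div, key, div_self hp]
  · have hne : (m : ℕ) ≠ n := fun h => hmn (Fin.ext h)
    rw [sum_eval_T_chebNode_eq_zero p _ (not_dvd _ (by omega) (by rw [abs_lt]; omega)),
      sum_eval_T_chebNode_eq_zero p _ (not_dvd _ (by omega) (by rw [abs_lt]; omega))] at key
    have : ∑ k : Fin p,
      (T ℝ (m : ℕ)).eval (chebNode p k) * (T ℝ (n : ℕ)).eval (chebNode p k) = 0 := by linarith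
    rw [this, mul_zero, if_neg hmn]

open Polynomial Polynomial.Chebyshev in
/-- Lagrange interpolation at the `p` Chebyshev nodes reproduces `T_m` for `m < p`. -/
theorem sum_eval_T_mul_chebLagrange (p : ℕ) (m : Fin p) (x : ℝ) :
    ∑ k : Fin p, (T ℝ (m : ℕ)).eval (chebNode p k) * chebLagrange p k x =
      (T ℝ (m : ℕ)).eval x := by
  have h := Lagrange.eq_interpolate (s := Finset.univ) (f := T ℝ (m : ℕ))
    (chebNode_injective p).injOn (by simp [degree_T])
  conv_rhs => rw [h]
  simp [Lagrange.interpolate_apply, eval_finsetSum, chebLagrange]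

open Polynomial Polynomial.Chebyshev Matrix in
/-- The sum of squares of the Lagrange basis in terms of Chebyshev polynomials. -/
theorem sum_chebLagrange_sq (p : ℕ) (x : ℝ) :
    ∑ k : Fin p, chebLagrange p k x ^ 2 =
      ∑ m : Fin p, chebWeight p m * (T ℝ (m : ℕ)).eval x ^ 2 := by
  set M : Matrix (Fin p) (Fin p) ℝ := of fun m k => (T ℝ (m : ℕ)).eval (chebNode p k) with hM
  set l : Fin p → ℝ := fun k => chebLagrange p k x with hl
  have hMl : M *ᵥ l = fun m : Fin p => (T ℝ (m : ℕ)).eval x := by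
    ext m
    exact sum_eval_T_mul_chebLagrange p m x
  have hWM : (diagonal (chebWeight p) * M) * Mᵀ = 1 := by
    ext m n
    rw [Matrix.mul_assoc, diagonal_mul, Matrix.one_apply]
    exact chebWeight_mul_sum_eval_T p m n
  have hMW := mul_eq_one_comm.mp hWM
  calc ∑ k : Fin p, chebLagrange p k x ^ 2 = l ⬝ᵥ (1 : Matrix (Fin p) (Fin p) ℝ) *ᵥ l := by
        simp [dotProduct, hl, sq]
    _ = (M *ᵥ l) ⬝ᵥ (diagonal (chebWeight p) *ᵥ (M *ᵥ l)) := by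
        rw [← hMW, ← mulVec_mulVec, ← mulVec_mulVec, dotProduct_mulVec, vecMul_transpose]
    _ = _ := by
        rw [hMl]
        simp only [dotProduct, mulVec_diagonal]
        exact Finset.sum_congr rfl fun m _ => by ring

theorem sum_chebWeight (p : ℕ) (hp : 1 ≤ p) : ∑ m : Fin p, chebWeight p m = 2 - 1 / p := by
  obtain ⟨q, rfl⟩ := Nat.exists_eq_add_of_le' hp
  simp only [chebWeight, Fin.sum_univ_succ, Fin.val_zero, Fin.val_succ, if_true,
    Nat.succ_ne_zero, if_false, Finset.sum_const, Finset.card_univ, Fintype.card_fin, nsmul_eq_mul]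
  push_cast
  field_simp
  ring

theorem chebWeight_nonneg (p : ℕ) (m : Fin p) : 0 ≤ chebWeight p m := by
  unfold chebWeight
  split_ifs <;> positivity

/-- Bound on the sum of squares of the Lagrange basis polynomials for the Chebyshev
nodes of the first kind: for `x ∈ [-1,1]`,
`∑_k ℓ_k(x)² ≤ ∑_k ℓ_k(1)² = 2 - 1/p`. -/
theorem chebLagrange_sq_sum_le (p : ℕ) (hp : 1 ≤ p) :
    (∀ x ∈ Set.Icc (-1 : ℝ) 1,
      ∑ k : Fin p, chebLagrange p k x ^ 2 ≤ ∑ k : Fin p, chebLagrange p k 1 ^ 2)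
    ∧ ∑ k : Fin p, chebLagrange p k 1 ^ 2 = 2 - 1 / p := by
  have h1 : ∑ k : Fin p, chebLagrange p k 1 ^ 2 = ∑ m : Fin p, chebWeight p m := by
    simp [sum_chebLagrange_sq]
  refine ⟨fun x hx => ?_, h1.trans (sum_chebWeight p hp)⟩
  rw [h1, sum_chebLagrange_sq]
  refine Finset.sum_le_sum fun m _ => mul_le_of_le_one_right (chebWeight_nonneg p m) ?_
  rw [sq_le_one_iff_abs_le_one]
  exact Polynomial.Chebyshev.abs_eval_T_real_le_one _ (abs_le.mpr hx)

end
end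

section
/- Let ω_j, ω_k ∈ ℝ with ω_j ≠ ω_k, and let τ ∈ [0,1]. Then ∫_0^τ K(τ − s, ω_k) K(s, ω_j) ds − ∫_τ^1 K(1 + τ − s, ω_k) K(s, ω_j) ds = (K(τ, ω_j) − K(τ, ω_k)) / (ω_k − ω_j), where K(τ,ω) = e^{−τω}/(1 + e^{−ω}). -/
noncomputable section

/-- The fermionic analytic continuation kernel `K(τ,ω) = e^{-τω}/(1+e^{-ω})`
(nondimensionalized, β = 1). -/
def kernelK (τ ω : ℝ) : ℝ := Real.exp (-τ * ω) / (1 + Real.exp (-ω))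

theorem kernelK_zero_add_kernelK_one (ω : ℝ) : kernelK 0 ω + kernelK 1 ω = 1 := by
  have h : 1 + Real.exp (-ω) ≠ 0 := by positivity
  simp only [kernelK, neg_zero, zero_mul, Real.exp_zero, neg_mul, one_mul]
  rw [← add_div, div_self h]

theorem hasDerivAt_kernelK (τ ω : ℝ) :
    HasDerivAt (fun t => kernelK t ω) (-ω * kernelK τ ω) τ := by
  have h := (((hasDerivAt_id τ).neg.mul_const ω).exp).div_const (1 + Real.exp (-ω))
  refine h.congr_deriv ?_
  simp only [kernelK, Pi.neg_apply, id]
  ring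

theorem hasDerivAt_kernelK_sub_mul (ωj ωk c s : ℝ) :
    HasDerivAt (fun t => kernelK (c - t) ωk * kernelK t ωj)
      ((ωk - ωj) * (kernelK (c - s) ωk * kernelK s ωj)) s := by
  refine (((hasDerivAt_kernelK (c - s) ωk).comp_const_sub c s).mul
    (hasDerivAt_kernelK s ωj)).congr_deriv ?_
  ring

theorem integral_kernelK_sub_mul {ωj ωk : ℝ} (hjk : ωj ≠ ωk) (a b c : ℝ) :
    ∫ s in a..b, kernelK (c - s) ωk * kernelK s ωj =
      (kernelK (c - b) ωk * kernelK b ωj - kernelK (c - a) ωk * kernelK a ωj) / (ωk - ωj) := by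
  have hd : ωk - ωj ≠ 0 := sub_ne_zero.mpr hjk.symm
  have hcont : Continuous fun s => kernelK (c - s) ωk * kernelK s ωj :=
    continuous_iff_continuousAt.mpr fun s =>
      (hasDerivAt_kernelK_sub_mul ωj ωk c s).continuousAt
  rw [eq_div_iff hd, mul_comm, ← intervalIntegral.integral_const_mul]
  exact intervalIntegral.integral_eq_sub_of_hasDerivAt
    (fun s _ => hasDerivAt_kernelK_sub_mul ωj ωk c s)
    ((hcont.const_mul _).intervalIntegrable a b)

/-- Off-diagonal entries of the tensor discretizing antiperiodic imaginary time
convolution of two DLR basis functions: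
`∫₀^τ K(τ-s,ω_k)K(s,ω_j) ds - ∫_τ^1 K(1+τ-s,ω_k)K(s,ω_j) ds
  = (K(τ,ω_j) - K(τ,ω_k))/(ω_k - ω_j)` for `ω_j ≠ ω_k`. -/
theorem kernelK_conv_offdiag (ωj ωk : ℝ) (hjk : ωj ≠ ωk) (τ : ℝ)
    (hτ : τ ∈ Set.Icc (0 : ℝ) 1) :
    (∫ s in (0 : ℝ)..τ, kernelK (τ - s) ωk * kernelK s ωj)
        - ∫ s in τ..(1 : ℝ), kernelK (1 + τ - s) ωk * kernelK s ωj
      = (kernelK τ ωj - kernelK τ ωk) / (ωk - ωj) := by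
  rw [integral_kernelK_sub_mul hjk, integral_kernelK_sub_mul hjk, ← sub_div]
  congr 1
  rw [sub_self, sub_zero, add_sub_cancel_left, add_sub_cancel_right]
  linear_combination kernelK τ ωj * kernelK_zero_add_kernelK_one ωk -
    kernelK τ ωk * kernelK_zero_add_kernelK_one ωj

end
end

section
/- Let ω ∈ ℝ and τ ∈ [0,1]. Then ∫_0^τ K(τ − s, ω) K(s, ω) ds − ∫_τ^1 K(1 + τ − s, ω) K(s, ω) ds = (τ − K(1, ω)) · K(τ, ω), where K(τ,ω) = e^{−τω}/(1 + e^{−ω}). -/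
noncomputable section

theorem kernelK_sub_mul_kernelK (a s ω : ℝ) :
    kernelK (a - s) ω * kernelK s ω = kernelK a ω / (1 + Real.exp (-ω)) := by
  have h : Real.exp (-a * ω) = Real.exp (-(a - s) * ω) * Real.exp (-s * ω) := by
    rw [← Real.exp_add]
    ring_nf
  rw [kernelK, kernelK, kernelK, h, div_mul_div_comm, div_div]

theorem kernelK_one_add (τ ω : ℝ) : kernelK (1 + τ) ω = Real.exp (-ω) * kernelK τ ω := by
  rw [kernelK, kernelK, ← mul_div_assoc, ← Real.exp_add]
  ring_nf

/-- Diagonal entries of the tensor discretizing antiperiodic imaginary time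
convolution of a DLR basis function with itself:
`∫₀^τ K(τ-s,ω)K(s,ω) ds - ∫_τ^1 K(1+τ-s,ω)K(s,ω) ds = (τ - K(1,ω)) K(τ,ω)`. -/
theorem kernelK_conv_diag (ω : ℝ) (τ : ℝ) (hτ : τ ∈ Set.Icc (0 : ℝ) 1) :
    (∫ s in (0 : ℝ)..τ, kernelK (τ - s) ω * kernelK s ω)
        - ∫ s in τ..(1 : ℝ), kernelK (1 + τ - s) ω * kernelK s ω
      = (τ - kernelK 1 ω) * kernelK τ ω := by
  have hD : 1 + Real.exp (-ω) ≠ 0 := by positivity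
  have hK : kernelK 1 ω = Real.exp (-ω) / (1 + Real.exp (-ω)) := by simp [kernelK]
  simp only [kernelK_sub_mul_kernelK, intervalIntegral.integral_const, smul_eq_mul,
    kernelK_one_add, hK]
  field_simp
  ring

end
end
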